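/- Let C be an additive category, let V₁ and V₂ be cochain complexes over C indexed by ℤ, and let V = V₁ ⊕ V₂ be their degreewise biproduct with the diagonal differential. Let e₁ : V₁ ⟶ V₁ be an isomorphism of cochain complexes, let e₂ : V₂ ⟶ V₂ be a cochain map each of whose degree-i components is a nilpotent endomorphism of V₂^i, and let e = e₁ ⊕ e₂ : V ⟶ V. Assume that e ∘ e is chain homotopic to e. Then the image of e in the homotopy category K(C) is a split idempotent: there exist morphisms r : V → V₁ and s : V₁ → V in K(C) such that r ∘ s = id on V₁ and s ∘ r equals the homotopy class of e. -/

import Mathlib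

open CategoryTheory Limits

/-- A degreewise nilpotent endomorphism of a homological complex differs from the identity by an
isomorphism. -/
theorem HomologicalComplex.isIso_id_sub_of_isNilpotent {C ι : Type*} [Category C] [Preadditive C]
    {c : ComplexShape ι} {K : HomologicalComplex C c} (f : K ⟶ K)
    (hf : ∀ i, IsNilpotent (R := End (K.X i)) (f.f i)) : IsIso (𝟙 K - f) := by
  have (i : ι) : IsIso ((𝟙 K - f).f i) := by
    have h : IsUnit (1 - (show End (K.X i) from f.f i)) := (hf i).isUnit_one_sub
    exact (isUnit_iff_isIso _).1 h
  exact HomologicalComplex.Hom.isIso_of_components _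

/-- An idempotent which is an isomorphism is the identity. -/
theorem CategoryTheory.eq_id_of_isIso_of_idem {D : Type*} [Category D] {X : D} (p : X ⟶ X)
    [IsIso p] (hp : p ≫ p = p) : p = 𝟙 X := by
  rw [← cancel_epi p, hp, Category.comp_id]

/-- An idempotent whose complement is an isomorphism is zero. -/
theorem CategoryTheory.eq_zero_of_isIso_id_sub_of_idem {D : Type*} [Category D] [Preadditive D]
    {X : D} (p : X ⟶ X) [IsIso (𝟙 X - p)] (hp : p ≫ p = p) : p = 0 := by
  rw [← cancel_mono (𝟙 X - p), Preadditive.comp_sub, hp, Category.comp_id, sub_self, zero_comp]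

/-- Let `V = V₁ ⊞ V₂` be a biproduct of cochain complexes over an additive
category, let `e = e₁ ⊕ e₂` where `e₁` is an isomorphism and `e₂` is degreewise nilpotent,
and assume `e ∘ e` is chain homotopic to `e`.  Then the image of `e` in the homotopy category
`K(C)` is a split idempotent, split through `V₁`. -/
theorem stmt5 {C : Type*} [Category C] [Preadditive C] [HasBinaryBiproducts C]
    (V₁ V₂ : CochainComplex C ℤ)
    (e₁ : V₁ ⟶ V₁) (e₂ : V₂ ⟶ V₂) [IsIso e₁]
    (hnil : ∀ i : ℤ, IsNilpotent (R := End (V₂.X i)) (e₂.f i))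
    (hidem : Nonempty (Homotopy (biprod.map e₁ e₂ ≫ biprod.map e₁ e₂) (biprod.map e₁ e₂))) :
    ∃ (r : (HomotopyCategory.quotient C (ComplexShape.up ℤ)).obj (V₁ ⊞ V₂) ⟶
            (HomotopyCategory.quotient C (ComplexShape.up ℤ)).obj V₁)
      (s : (HomotopyCategory.quotient C (ComplexShape.up ℤ)).obj V₁ ⟶
            (HomotopyCategory.quotient C (ComplexShape.up ℤ)).obj (V₁ ⊞ V₂)),
      s ≫ r = 𝟙 _ ∧
      r ≫ s = (HomotopyCategory.quotient C (ComplexShape.up ℤ)).map (biprod.map e₁ e₂) := by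
  let Q := HomotopyCategory.quotient C (ComplexShape.up ℤ)
  obtain ⟨h⟩ := hidem
  have hE : Q.map (biprod.map e₁ e₂ ≫ biprod.map e₁ e₂) = Q.map (biprod.map e₁ e₂) :=
    HomotopyCategory.eq_of_homotopy _ _ h
  have h₁ : Q.map e₁ ≫ Q.map e₁ = Q.map e₁ := by
    simpa [← Functor.map_comp] using
      congrArg (fun f => Q.map biprod.inl ≫ f ≫ Q.map biprod.fst) hE
  have h₂ : Q.map e₂ ≫ Q.map e₂ = Q.map e₂ := by
    simpa [← Functor.map_comp] using
      congrArg (fun f => Q.map biprod.inr ≫ f ≫ Q.map biprod.snd) hE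
  have h₁_id : Q.map e₁ = 𝟙 _ := eq_id_of_isIso_of_idem _ h₁
  have : IsIso (𝟙 V₂ - e₂) := HomologicalComplex.isIso_id_sub_of_isNilpotent e₂ hnil
  have : IsIso (𝟙 (Q.obj V₂) - Q.map e₂) := by
    rw [← Q.map_id, ← Q.map_sub]
    infer_instance
  have h₂_zero : Q.map e₂ = 0 := eq_zero_of_isIso_id_sub_of_idem _ h₂
  refine ⟨Q.map biprod.fst, Q.map biprod.inl, ?_, ?_⟩
  · rw [← Q.map_comp, biprod.inl_fst, Q.map_id]
  · change _ = Q.map (biprod.map e₁ e₂)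
    have map_eq : biprod.map e₁ e₂ =
        biprod.fst ≫ e₁ ≫ biprod.inl + biprod.snd ≫ e₂ ≫ biprod.inr := by
      apply biprod.hom_ext <;> apply biprod.hom_ext' <;> simp
    rw [map_eq, Q.map_add]
    simp [h₁_id, h₂_zero]
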